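/- Let S be an abstract Cu-semigroup with a greatest element ω, and suppose that every y ∈ S with λ(y) = ∞ for all nonzero λ ∈ F(S) satisfies y = ω. Let (x_i)_{i≥1} and (y_i)_{i≥1} be sequences in S such that x_i ≤ x_{i+1} and x_i ≤_s y_i for all i, and such that sup_i x_i is full. Then Σ_{i=1}^∞ y_i = ω. (This is the order-semigroup content of the implication (iii) ⇒ (i) in the paper's Theorem 4.2, applied to S = Cu(A) when r_{A,∞} = 0.) -/

import Mathlib

open scoped ENNReal

/-- Compact containment relation: `x ≪ y`. -/
def CuWayBelow {S : Type*} [Preorder S] (x y : S) : Prop :=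
  ∀ f : ℕ → S, Monotone f → IsLUB (Set.range f) y → ∃ n, x ≤ f n

/-- An abstract Cu-semigroup. -/
class CuSemigroup (S : Type*) extends AddCommMonoid S, PartialOrder S where
  zero_le (x : S) : 0 ≤ x
  add_le_add {x₁ x₂ y₁ y₂ : S} : x₁ ≤ y₁ → x₂ ≤ y₂ → x₁ + x₂ ≤ y₁ + y₂
  exists_sup (f : ℕ → S) : Monotone f → ∃ s, IsLUB (Set.range f) s
  exists_rapid (x : S) : ∃ f : ℕ → S,
    (∀ n, CuWayBelow (f n) (f (n + 1))) ∧ IsLUB (Set.range f) x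
  wayBelow_directed_le (x : S) : DirectedOn (· ≤ ·) {z : S | CuWayBelow z x}
  wayBelow_directed_wb (x : S) : DirectedOn CuWayBelow {z : S | CuWayBelow z x}
  add_wayBelow {x₁ x₂ y₁ y₂ : S} :
    CuWayBelow x₁ y₁ → CuWayBelow x₂ y₂ → CuWayBelow (x₁ + x₂) (y₁ + y₂)
  add_isLUB {f g : ℕ → S} {a b : S} : Monotone f → Monotone g →
    IsLUB (Set.range f) a → IsLUB (Set.range g) b →
    IsLUB (Set.range fun n => f n + g n) (a + b)

/-- A functional on a Cu-semigroup. -/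
structure IsCuFunctional {S : Type*} [CuSemigroup S] (lam : S → ℝ≥0∞) : Prop where
  map_zero : lam 0 = 0
  map_add : ∀ x y : S, lam (x + y) = lam x + lam y
  mono : Monotone lam
  map_sup : ∀ (f : ℕ → S) (s : S), Monotone f → IsLUB (Set.range f) s →
    lam s = ⨆ n, lam (f n)

/-- `e` is full: the supremum of `n • e` is the greatest element. -/
def CuFull {S : Type*} [CuSemigroup S] (e : S) : Prop :=
  ∀ w : S, IsLUB (Set.range fun n : ℕ => n • e) w → ∀ x : S, x ≤ w

/-- Condition (R1) for `(S, e)` and `r`. -/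
def CuR1 {S : Type*} [CuSemigroup S] (e : S) (r : ℝ) : Prop :=
  ∀ x y : S,
    (∀ lam : S → ℝ≥0∞, IsCuFunctional lam →
      lam x + ENNReal.ofReal r * lam e ≤ lam y) → x ≤ y

/-- Condition (R2) for `(S, e)` and `r`. -/
def CuR2 {S : Type*} [CuSemigroup S] (e : S) (r : ℝ) : Prop :=
  ∀ x y : S,
    (∃ n m : ℕ, 0 < n ∧ 0 < m ∧ r < (m : ℝ) / (n : ℝ) ∧
      (n + 1) • x + m • e ≤ n • y) → x ≤ y

/-- Condition (R2') for `(S, e)` and `r`. -/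
def CuR2' {S : Type*} [CuSemigroup S] (e : S) (r : ℝ) : Prop :=
  ∀ x y : S,
    (∀ x' e' : S, CuWayBelow x' x → CuWayBelow e' e →
      ∃ n m : ℕ, 0 < n ∧ 0 < m ∧ r < (m : ℝ) / (n : ℝ) ∧
        (n + 1) • x' + m • e' ≤ n • y) → x ≤ y

/-- The radius of comparison of `(S, e)`. -/
noncomputable def cuRadius {S : Type*} [CuSemigroup S] (e : S) : ℝ≥0∞ :=
  sInf {t : ℝ≥0∞ | ∃ r : ℝ, 0 < r ∧ CuR1 e r ∧ t = ENNReal.ofReal r}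

/-- In a Cu-semigroup every element is nonnegative, so adding an element increases. -/
theorem CuSemigroup.le_add_right {S : Type*} [CuSemigroup S] (a b : S) : a ≤ a + b := by
  simpa using CuSemigroup.add_le_add (le_refl a) (CuSemigroup.zero_le b)

theorem CuSemigroup.monotone_nsmul {S : Type*} [CuSemigroup S] (e : S) :
    Monotone fun n : ℕ => n • e :=
  monotone_nat_of_le_succ fun n => by
    simpa only [succ_nsmul] using CuSemigroup.le_add_right (n • e) e

theorem CuSemigroup.monotone_sum_range {S : Type*} [CuSemigroup S] (y : ℕ → S) :
    Monotone fun N => ∑ i ∈ Finset.range N, y i :=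
  monotone_nat_of_le_succ fun n => by
    simpa only [Finset.sum_range_succ] using CuSemigroup.le_add_right _ (y n)

namespace IsCuFunctional

variable {S : Type*} [CuSemigroup S] {lam : S → ℝ≥0∞}

theorem map_nsmul (h : IsCuFunctional lam) (n : ℕ) (a : S) : lam (n • a) = n * lam a := by
  induction n with
  | zero => simp [h.map_zero]
  | succ n ih => rw [succ_nsmul, h.map_add, ih, Nat.cast_succ, add_one_mul]

/-- Functionals respect the relation `≤ₛ`. -/
theorem le_of_succ_nsmul_le (h : IsCuFunctional lam) {a b : S} {k : ℕ} (hk : 0 < k)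
    (hab : (k + 1) • a ≤ k • b) : lam a ≤ lam b := by
  have hk' : k • a ≤ k • b :=
    (CuSemigroup.monotone_nsmul a (Nat.le_succ k)).trans hab
  have hmul := h.mono hk'
  rw [h.map_nsmul, h.map_nsmul] at hmul
  exact (ENNReal.mul_le_mul_iff_right (by exact_mod_cast hk.ne')
    (ENNReal.natCast_ne_top k)).1 hmul

/-- A functional vanishing at a full element vanishes everywhere. -/
theorem eq_zero_of_full (h : IsCuFunctional lam) {e : S} (he : CuFull e) (h0 : lam e = 0) :
    lam = 0 := by
  obtain ⟨w, hw⟩ := CuSemigroup.exists_sup _ (CuSemigroup.monotone_nsmul e)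
  have hw0 : lam w = 0 := by
    simp [h.map_sup _ w (CuSemigroup.monotone_nsmul e) hw, h.map_nsmul, h0]
  funext z
  exact le_antisymm ((h.mono (he w hw z)).trans_eq hw0) zero_le

/-- If a functional is eventually bounded below by `c` along `y`, then its values on the partial
sums of `y` grow at least linearly with slope `c`. -/
theorem natCast_mul_le_map_sum (h : IsCuFunctional lam) {y : ℕ → S} {c : ℝ≥0∞} {i : ℕ}
    (hc : ∀ j, i ≤ j → c ≤ lam (y j)) (n : ℕ) :
    n * c ≤ lam (∑ j ∈ Finset.range (i + n), y j) := by
  induction n with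
  | zero => simp
  | succ n ih =>
    rw [← add_assoc, Finset.sum_range_succ, h.map_add, Nat.cast_succ, add_one_mul]
    exact add_le_add ih (hc _ (Nat.le_add_right i n))

end IsCuFunctional

/-- Order-semigroup form of (iii) ⇒ (i) in Theorem 4.2: if the only element on
which every nonzero functional is infinite is the greatest element ω, then for
increasing (x_i) with x_i ≤ₛ y_i and sup x_i full, one has Σ y_i = ω. -/
theorem cu_sum_eq_top {S : Type*} [CuSemigroup S] (ω : S) (hω : ∀ z : S, z ≤ ω)
    (H : ∀ y : S,
      (∀ lam : S → ℝ≥0∞, IsCuFunctional lam → lam ≠ 0 → lam y = ∞) → y = ω)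
    (x y : ℕ → S) (hx : Monotone x)
    (hxy : ∀ i, ∃ k : ℕ, 0 < k ∧ (k + 1) • x i ≤ k • y i)
    (xsup : S) (hxsup : IsLUB (Set.range x) xsup) (hfull : CuFull xsup)
    (s : S) (hsum : IsLUB (Set.range fun N => ∑ i ∈ Finset.range N, y i) s) :
    s = ω := by
  refine H s fun lam hlam hne => ?_
  have hpos : lam xsup ≠ 0 := fun h0 => hne (hlam.eq_zero_of_full hfull h0)
  obtain ⟨i, hi⟩ : ∃ i, lam (x i) ≠ 0 := by
    by_contra! hzero
    exact hpos (by simp [hlam.map_sup x xsup hx hxsup, hzero])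
  have hc : ∀ j, i ≤ j → lam (x i) ≤ lam (y j) := fun j hij => by
    obtain ⟨k, hk, hle⟩ := hxy j
    exact (hlam.mono (hx hij)).trans (hlam.le_of_succ_nsmul_le hk hle)
  have hbound : ∀ n : ℕ, n * lam (x i) ≤ lam s := fun n =>
    (hlam.natCast_mul_le_map_sum hc n).trans (hlam.mono (hsum.1 ⟨i + n, rfl⟩))
  by_contra hfin
  obtain ⟨n, hn⟩ := ENNReal.exists_nat_mul_gt hi hfin
  exact absurd (hbound n) hn.not_ge
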